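/- Let C ⊆ ℝⁿ be a nonempty closed convex set and f : ℝⁿ → ℝ be continuously differentiable satisfying condition (B) on C. Then for each x ∈ C, the set D_x := {p ∈ C : ⟨∇f(x), p − x⟩ ≤ 0} is compact. -/

import Mathlib

open scoped RealInnerProductSpace

/-- If `C ⊆ ℝⁿ` is nonempty, closed and convex, `f` is continuously differentiable and
satisfies condition (B) on `C` (i.e. `⟪∇f x, d⟫ > 0` for every `x ∈ C` and every nonzero
`d` in the asymptotic cone of `C`), then for each `x ∈ C` the set
`D_x = {p ∈ C : ⟪∇f x, p - x⟫ ≤ 0}` is compact. -/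
theorem sublevel_compact (n : ℕ) (C : Set (EuclideanSpace ℝ (Fin n)))
    (hCne : C.Nonempty) (hCcl : IsClosed C) (hCconv : Convex ℝ C)
    (f : EuclideanSpace ℝ (Fin n) → ℝ) (hf : ContDiff ℝ 1 f)
    (hB : ∀ x ∈ C, ∀ d : EuclideanSpace ℝ (Fin n),
      (∀ y ∈ C, ∀ t : ℝ, 0 ≤ t → y + t • d ∈ C) → d ≠ 0 → 0 < ⟪gradient f x, d⟫)
    (x : EuclideanSpace ℝ (Fin n)) (hx : x ∈ C) :
    IsCompact {p | p ∈ C ∧ ⟪gradient f x, p - x⟫ ≤ 0} := by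
  set D : Set (EuclideanSpace ℝ (Fin n)) := {p | p ∈ C ∧ ⟪gradient f x, p - x⟫ ≤ 0}
  have hDC : D ⊆ C := fun p hp => hp.1
  have hDcl : IsClosed D :=
    hCcl.inter (isClosed_le (f := fun p => ⟪gradient f x, p - x⟫) (by fun_prop)
      continuous_const)
  have hDconv : Convex ℝ D := by
    intro p hp q hq a b ha hb hab
    refine ⟨hCconv hp.1 hq.1 ha hb hab, ?_⟩
    have hsplit : a • p + b • q - x = a • (p - x) + b • (q - x) := by
      rw [smul_sub, smul_sub, sub_add_sub_comm, ← add_smul, hab, one_smul]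
    rw [hsplit, inner_add_right, inner_smul_right, inner_smul_right]
    exact add_nonpos (mul_nonpos_of_nonneg_of_nonpos ha hp.2)
      (mul_nonpos_of_nonneg_of_nonpos hb hq.2)
  refine Metric.isCompact_of_isClosed_isBounded hDcl ?_
  by_contra hunb
  obtain ⟨v, hv0, hv⟩ := not_bounded_iff_exists_ne_zero_mem_asymptoticCone.mp hunb
  have hvC : ∀ y ∈ C, ∀ t : ℝ, 0 ≤ t → y + t • v ∈ C := fun y hy t ht => by
    simpa only [vadd_eq_add, add_comm] using
      hCconv.smul_vadd_mem_of_isClosed_of_mem_asymptoticCone hCcl ht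
        (asymptoticCone_mono hDC hv) hy
  have hxD : x ∈ D := ⟨hx, by simp⟩
  have hvD := (hDconv.smul_vadd_mem_of_isClosed_of_mem_asymptoticCone hDcl zero_le_one hv hxD).2
  rw [one_smul, vadd_eq_add, add_sub_cancel_right] at hvD
  exact (hB x hx v hvC hv0).not_ge hvD
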